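/- Let 0 < p ≤ 1 and let (α_k) be a sequence of positive integers such that ϰ := sup_k ( |α_k| − ⟨α_k⟩ ) < ∞. Then there exists a constant c > 0, depending only on p, λ = sup_k m_k and ϰ, such that for every martingale f ∈ H_p the restricted maximal operator satisfies ‖ sup_{k∈ℕ} |S_{α_k} f| ‖_{L_p(μ)} ≤ c · ‖f‖_{H_p}. -/

import Mathlib

open MeasureTheory Complex Finset
open scoped BigOperators ENNReal NNReal

noncomputable section

instance (n : ℕ) : MeasurableSpace (ZMod n) := ⊤

/-- The Vilenkin group determined by the generating sequence `m`. -/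
abbrev Gm (m : ℕ → ℕ) : Type := ∀ _k : ℕ, ZMod (m _k)

namespace Vilenkin

variable (m : ℕ → ℕ)

/-- The generalized powers `M_0 = 1`, `M_{k+1} = m_k · M_k`. -/
def M : ℕ → ℕ
  | 0 => 1
  | k + 1 => m k * M k

/-- The `j`-th digit `n_j` of `n` in the generalized number system based on `m`. -/
def digit (n j : ℕ) : ℕ := n / M m j % m j

/-- `|n|`, the index of the highest nonzero digit of `n`. -/
def hi (n : ℕ) : ℕ := Nat.findGreatest (fun j => digit m n j ≠ 0) n

/-- `⟨n⟩`, the index of the lowest nonzero digit of `n`. -/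
def lo (n : ℕ) : ℕ := sInf {j | digit m n j ≠ 0}

/-- The generalized Rademacher functions `r_k(x) = exp(2πi x_k / m_k)`. -/
def rad (k : ℕ) (x : Gm m) : ℂ :=
  Complex.exp (2 * Real.pi * Complex.I * ((x k).val : ℂ) / (m k : ℂ))

/-- The Vilenkin functions `ψ_n = ∏_k r_k^{n_k}`. -/
def vil (n : ℕ) (x : Gm m) : ℂ :=
  ∏ k ∈ Finset.range (n + 1), rad m k x ^ digit m n k

/-- The Dirichlet kernels `D_n = ∑_{k=0}^{n-1} ψ_k`. -/
def D (n : ℕ) (x : Gm m) : ℂ := ∑ k ∈ Finset.range n, vil m k x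

/-- The Fejér kernels `K_n = (1/n) ∑_{k=1}^{n} D_k`. -/
def K (n : ℕ) (x : Gm m) : ℂ := (n : ℂ)⁻¹ * ∑ k ∈ Finset.range n, D m (k + 1) x

/-- The Nörlund kernels `F_n = (1/Q_n) ∑_{k=1}^{n} q_{n-k} D_k` where
`Q_n = ∑_{k=0}^{n-1} q_k`. -/
def FK (q : ℕ → ℝ) (n : ℕ) (x : Gm m) : ℂ :=
  ((∑ k ∈ Finset.range n, q k : ℝ) : ℂ)⁻¹ *
    ∑ k ∈ Finset.range n, (q (n - (k + 1)) : ℂ) * D m (k + 1) x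

/-- The cylinder subgroup `I_n = {x : x_0 = … = x_{n-1} = 0}`. -/
def I (n : ℕ) : Set (Gm m) := {x | ∀ k < n, x k = 0}

/-- The cylinder of length `n` around `x`. -/
def cylAt (n : ℕ) (x : Gm m) : Set (Gm m) := {y | ∀ k < n, y k = x k}

/-- `μ` is the normalized Haar measure of `G_m`: the (unique) Borel probability
measure giving each cylinder of length `n` measure `1 / M_n`. -/
def IsHaar (μ : Measure (Gm m)) : Prop :=
  ∀ (n : ℕ) (x : Gm m), μ (cylAt m n x) = (M m n : ℝ≥0∞)⁻¹

/-- A martingale with respect to the filtration `(ℱ_n)` on `G_m`, where `ℱ_n` is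
generated by the first `n` coordinates: each `f n` is integrable and depends only
on the first `n` coordinates, and the conditional expectation of `f N` with
respect to `ℱ_n` (which under the Haar measure is given by averaging over the
cylinders of length `n`) equals `f n` for `n ≤ N`. -/
structure IsMartingale (μ : Measure (Gm m)) (f : ℕ → Gm m → ℂ) : Prop where
  integrable : ∀ n, Integrable (f n) μ
  adapted : ∀ (n : ℕ) (x y : Gm m), (∀ k < n, x k = y k) → f n x = f n y
  mart : ∀ n N : ℕ, n ≤ N → ∀ x : Gm m,
    f n x = (M m n : ℂ) * ∫ t in cylAt m n x, f N t ∂μ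

/-- The Vilenkin–Fourier coefficients of a martingale:
`f̂(i) = lim_k ∫ f^(k) conj(ψ_i) dμ`; for a martingale these integrals are
constant as soon as `M_k > i`, in particular from `k = i + 1` on. -/
def coeff (μ : Measure (Gm m)) (f : ℕ → Gm m → ℂ) (i : ℕ) : ℂ :=
  ∫ x, f (i + 1) x * (starRingEnd ℂ) (vil m i x) ∂μ

/-- The partial sums `S_n f = ∑_{k=0}^{n-1} f̂(k) ψ_k`. -/
def S (μ : Measure (Gm m)) (f : ℕ → Gm m → ℂ) (n : ℕ) (x : Gm m) : ℂ :=
  ∑ k ∈ Finset.range n, coeff m μ f k * vil m k x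

/-- The Fejér means `σ_n f = (1/n) ∑_{k=1}^{n} S_k f`. -/
def sigma (μ : Measure (Gm m)) (f : ℕ → Gm m → ℂ) (n : ℕ) (x : Gm m) : ℂ :=
  (n : ℂ)⁻¹ * ∑ k ∈ Finset.range n, S m μ f (k + 1) x

/-- The Nörlund means `t_n f = (1/Q_n) ∑_{k=1}^{n} q_{n-k} S_k f`. -/
def T (μ : Measure (Gm m)) (q : ℕ → ℝ) (f : ℕ → Gm m → ℂ) (n : ℕ) (x : Gm m) : ℂ :=
  ((∑ k ∈ Finset.range n, q k : ℝ) : ℂ)⁻¹ *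
    ∑ k ∈ Finset.range n, (q (n - (k + 1)) : ℂ) * S m μ f (k + 1) x

/-- The martingale maximal function `f* = sup_n |f^(n)|`. -/
def mstar (f : ℕ → Gm m → ℂ) (x : Gm m) : ℝ≥0∞ := ⨆ n, (‖f n x‖₊ : ℝ≥0∞)

/-- The `L_p`-type quasi-norm `(∫ g^p dμ)^{1/p}` of an `ℝ≥0∞`-valued function. -/
def eLp (μ : Measure (Gm m)) (p : ℝ) (g : Gm m → ℝ≥0∞) : ℝ≥0∞ :=
  (∫⁻ x, g x ^ p ∂μ) ^ (1 / p)

/-- Membership in the martingale Hardy space `H_p`: `‖f‖_{H_p} = ‖f*‖_{L_p} < ∞`. -/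
def MemHp (μ : Measure (Gm m)) (p : ℝ) (f : ℕ → Gm m → ℂ) : Prop :=
  eLp m μ p (mstar m f) ≠ ⊤

/-- The weak-`L_p` quasi-norm `sup_{t>0} t · μ(g > t)^{1/p}`. -/
def wLp (μ : Measure (Gm m)) (p : ℝ) (g : Gm m → ℝ≥0∞) : ℝ≥0∞ :=
  ⨆ t : ℝ≥0, (t : ℝ≥0∞) * μ {x | (t : ℝ≥0∞) < g x} ^ (1 / p)

end Vilenkin

namespace Vilenkin

variable {m : ℕ → ℕ}

lemma M_pos (hm : ∀ k, 2 ≤ m k) (k : ℕ) : 0 < M m k := by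
  induction k with
  | zero => simp [M]
  | succ k ih => exact Nat.mul_pos (by have := hm k; omega) ih

lemma lt_M (hm : ∀ k, 2 ≤ m k) (k : ℕ) : k < M m k := by
  induction k with
  | zero => simp [M]
  | succ k ih =>
    have : 2 * M m k ≤ m k * M m k := Nat.mul_le_mul_right _ (hm k)
    simp only [M]
    omega

lemma M_dvd_M {k l : ℕ} (h : k ≤ l) : M m k ∣ M m l := by
  induction l, h using Nat.le_induction with
  | base => exact dvd_rfl
  | succ l _ ih => exact ih.trans ⟨m l, mul_comm _ _⟩

lemma M_le_M (hm : ∀ k, 2 ≤ m k) {k l : ℕ} (h : k ≤ l) : M m k ≤ M m l :=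
  Nat.le_of_dvd (M_pos hm l) (M_dvd_M h)

lemma M_add_le {lam : ℕ} (hlam : ∀ k, m k ≤ lam) (s d : ℕ) :
    M m (s + d) ≤ lam ^ d * M m s := by
  induction d with
  | zero => simp
  | succ d ih =>
    calc M m (s + (d + 1)) = m (s + d) * M m (s + d) := rfl
      _ ≤ lam * (lam ^ d * M m s) := Nat.mul_le_mul (hlam _) ih
      _ = lam ^ (d + 1) * M m s := by ring

lemma digit_eq_zero_of_lt {n k : ℕ} (h : n < M m k) : digit m n k = 0 := by
  simp [digit, Nat.div_eq_of_lt h]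

lemma digit_eq_zero_of_le (hm : ∀ k, 2 ≤ m k) {n k : ℕ} (h : n ≤ k) : digit m n k = 0 :=
  digit_eq_zero_of_lt (h.trans_lt (lt_M hm k))

lemma digit_mul_add_of_lt (hm : ∀ k, 2 ≤ m k) {s k : ℕ} (h : k < s) (i r : ℕ) :
    digit m (i * M m s + r) k = digit m r k := by
  obtain ⟨c, hc⟩ : M m (k + 1) ∣ M m s := M_dvd_M h
  have : i * M m s + r = M m k * (m k * (c * i)) + r := by rw [hc, M]; ring
  rw [digit, digit, this, Nat.mul_add_div (M_pos hm k), Nat.mul_add_mod]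

lemma digit_mul_add_of_le (hm : ∀ k, 2 ≤ m k) {s k : ℕ} (h : s ≤ k) (i : ℕ) {r : ℕ}
    (hr : r < M m s) : digit m (i * M m s + r) k = digit m (i * M m s) k := by
  obtain ⟨e, he⟩ : M m s ∣ M m k := M_dvd_M h
  have key : ∀ r < M m s, (i * M m s + r) / M m k = i / e := fun r hr => by
    rw [he, ← Nat.div_div_eq_div_mul, mul_comm i, Nat.mul_add_div (M_pos hm s),
      Nat.div_eq_of_lt hr, add_zero]
  rw [digit, digit, key r hr, ← key 0 (M_pos hm s), add_zero]

lemma digit_mul_add (hm : ∀ k, 2 ≤ m k) (s i k : ℕ) {r : ℕ} (hr : r < M m s) :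
    digit m (i * M m s + r) k = digit m (i * M m s) k + digit m r k := by
  rcases lt_or_ge k s with h | h
  · have := digit_mul_add_of_lt hm h i 0
    have h0 : digit m 0 k = 0 := by simp [digit]
    rw [digit_mul_add_of_lt hm h, ← add_zero (i * M m s), this, h0, zero_add]
  · rw [digit_mul_add_of_le hm h i hr, digit_eq_zero_of_lt (hr.trans_le (M_le_M hm h)), add_zero]

lemma lt_M_hi_succ (hm : ∀ k, 2 ≤ m k) (n : ℕ) : n < M m (hi m n + 1) := by
  have key : ∀ j, hi m n + 1 ≤ j → digit m n j = 0 := fun j hj => by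
    rcases le_total n j with h | h
    · exact digit_eq_zero_of_le hm h
    · by_contra hne
      have : j ≤ hi m n := Nat.le_findGreatest (P := fun j => digit m n j ≠ 0) h hne
      omega
  have step : ∀ d, n < M m (hi m n + 1 + d) → n < M m (hi m n + 1) := by
    intro d
    induction d with
    | zero => exact id
    | succ d ih =>
      refine fun h => ih ?_
      have h0 : n / M m (hi m n + 1 + d) % m (hi m n + 1 + d) = 0 := key _ (by omega)
      have h1 : n / M m (hi m n + 1 + d) < m (hi m n + 1 + d) :=
        (Nat.div_lt_iff_lt_mul (M_pos hm _)).2 h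
      rw [Nat.mod_eq_of_lt h1] at h0
      exact (Nat.div_eq_zero_iff_lt (M_pos hm _)).1 h0
  exact step n ((lt_M hm n).trans_le (M_le_M hm (by omega)))

lemma M_lo_dvd (n : ℕ) : M m (lo m n) ∣ n := by
  have : ∀ j, j ≤ lo m n → M m j ∣ n := by
    intro j
    induction j with
    | zero => simp [M]
    | succ j ih =>
      intro h
      obtain ⟨c, hc⟩ := ih (by omega)
      have h0 : digit m n j = 0 := by
        by_contra hne
        have : lo m n ≤ j := Nat.sInf_le hne
        omega
      rcases Nat.eq_zero_or_pos (M m j) with hM | hM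
      · simp [hc, hM]
      rw [digit, hc, Nat.mul_div_cancel_left _ hM] at h0
      rw [hc, M, mul_comm]
      exact mul_dvd_mul_left _ (Nat.dvd_of_mod_eq_zero h0)
  exact this _ le_rfl

lemma vil_eq_prod (hm : ∀ k, 2 ≤ m k) {n L : ℕ} (h : n ≤ L) (x : Gm m) :
    vil m n x = ∏ k ∈ range (L + 1), rad m k x ^ digit m n k := by
  refine Finset.prod_subset (range_subset_range.2 (by omega)) fun k _ hk => ?_
  rw [digit_eq_zero_of_le hm (by simp at hk; omega), pow_zero]

lemma vil_mul_add (hm : ∀ k, 2 ≤ m k) (s i : ℕ) {r : ℕ} (hr : r < M m s) (x : Gm m) :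
    vil m (i * M m s + r) x = vil m (i * M m s) x * vil m r x := by
  rw [vil_eq_prod hm le_rfl, vil_eq_prod hm (Nat.le_add_right (i * M m s) r),
    vil_eq_prod hm (Nat.le_add_left r (i * M m s)), ← Finset.prod_mul_distrib]
  exact Finset.prod_congr rfl fun k _ => by rw [digit_mul_add hm s i k hr, pow_add]

lemma vil_mul_M (hm : ∀ k, 2 ≤ m k) {s i : ℕ} (hi : i < m s) (x : Gm m) :
    vil m (i * M m s) x = rad m s x ^ i := by
  rw [vil_eq_prod hm (Nat.le_add_right (i * M m s) s), Finset.prod_eq_single s]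
  · rw [digit, Nat.mul_div_cancel _ (M_pos hm s), Nat.mod_eq_of_lt hi]
  · intro k _ hk
    have : digit m (i * M m s) k = 0 := by
      rcases lt_or_gt_of_ne hk with h | h
      · simpa [digit] using digit_mul_add_of_lt hm h i 0
      · refine digit_eq_zero_of_lt (lt_of_lt_of_le ?_ (M_le_M hm h))
        exact Nat.mul_lt_mul_of_pos_right hi (M_pos hm s)
    rw [this, pow_zero]
  · simp

lemma norm_rad (k : ℕ) (x : Gm m) : ‖rad m k x‖ = 1 := by
  have : 2 * Real.pi * Complex.I * ((x k).val : ℂ) / (m k : ℂ)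
      = ((2 * Real.pi * (x k).val / m k : ℝ) : ℂ) * Complex.I := by
    push_cast; ring
  rw [rad, this, Complex.norm_exp_ofReal_mul_I]

lemma norm_vil (n : ℕ) (x : Gm m) : ‖vil m n x‖ = 1 := by
  simp [vil, norm_prod, norm_rad]

lemma rad_eq_pow (k : ℕ) (x : Gm m) :
    rad m k x = Complex.exp (2 * Real.pi * Complex.I / (m k : ℂ)) ^ (x k).val := by
  rw [← Complex.exp_nat_mul, rad]; congr 1; ring

lemma rad_pow (hm : ∀ k, 2 ≤ m k) (k : ℕ) (x : Gm m) : rad m k x ^ m k = 1 := by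
  rw [rad_eq_pow, ← pow_mul, mul_comm (x k).val, pow_mul,
    (Complex.isPrimitiveRoot_exp _ (by have := hm k; omega)).pow_eq_one, one_pow]

lemma rad_inj (hm : ∀ k, 2 ≤ m k) {k : ℕ} {x y : Gm m} (h : rad m k x = rad m k y) :
    x k = y k := by
  have h0 : m k ≠ 0 := by have := hm k; omega
  have : NeZero (m k) := ⟨h0⟩
  rw [rad_eq_pow, rad_eq_pow] at h
  exact ZMod.val_injective _ ((Complex.isPrimitiveRoot_exp _ h0).pow_inj
    (ZMod.val_lt _) (ZMod.val_lt _) h)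

/-- The kernel `∑_{k<n} ψ_k(x) conj(ψ_k(y))` of the partial sum operator `S_n`. -/
def ker (n : ℕ) (x y : Gm m) : ℂ :=
  ∑ k ∈ range n, vil m k x * (starRingEnd ℂ) (vil m k y)

lemma norm_ker_le (n : ℕ) (x y : Gm m) : ‖ker n x y‖ ≤ n := by
  refine (norm_sum_le _ _).trans ?_
  simp [norm_vil]

lemma ker_mul (hm : ∀ k, 2 ≤ m k) (s j : ℕ) (x y : Gm m) :
    ker (j * M m s) x y =
      (∑ i ∈ range j, vil m (i * M m s) x * (starRingEnd ℂ) (vil m (i * M m s) y)) *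
        ker (M m s) x y := by
  induction j with
  | zero => simp [ker]
  | succ j ih =>
    rw [add_mul, one_mul, ker, Finset.sum_range_add, ← ker, ih, Finset.sum_range_succ, add_mul]
    congr 1
    rw [ker, Finset.mul_sum]
    refine Finset.sum_congr rfl fun r hr => ?_
    rw [vil_mul_add hm s j (mem_range.1 hr), vil_mul_add hm s j (mem_range.1 hr), map_mul]
    ring

lemma ker_M_eq_zero (hm : ∀ k, 2 ≤ m k) {s k : ℕ} (hk : k < s) {x y : Gm m}
    (hxy : y k ≠ x k) : ker (M m s) x y = 0 := by
  induction s with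
  | zero => omega
  | succ s ih =>
    rw [M, ker_mul hm]
    rcases Nat.lt_succ_iff_lt_or_eq.1 hk with h | rfl
    · rw [ih h, mul_zero]
    · have hz : ∀ i ∈ range (m k), vil m (i * M m k) x * (starRingEnd ℂ) (vil m (i * M m k) y)
          = (rad m k x * (starRingEnd ℂ) (rad m k y)) ^ i := fun i hi => by
        rw [vil_mul_M hm (mem_range.1 hi), vil_mul_M hm (mem_range.1 hi), map_pow, mul_pow]
      have hy : (starRingEnd ℂ) (rad m k y) * rad m k y = 1 := by
        rw [mul_comm, Complex.mul_conj, Complex.normSq_eq_norm_sq, norm_rad]; simp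
      have hne : rad m k x * (starRingEnd ℂ) (rad m k y) ≠ 1 := fun h => hxy <| by
        refine (rad_inj hm ?_).symm
        calc rad m k x = rad m k x * ((starRingEnd ℂ) (rad m k y) * rad m k y) := by
              rw [hy, mul_one]
          _ = rad m k y := by rw [← mul_assoc, h, one_mul]
      rw [Finset.sum_congr rfl hz, geom_sum_eq hne, mul_pow, ← map_pow, rad_pow hm, rad_pow hm]
      simp

lemma ker_eq_zero (hm : ∀ k, 2 ≤ m k) {n s : ℕ} (hn : M m s ∣ n) {x y : Gm m}
    (hy : y ∉ cylAt m s x) : ker n x y = 0 := by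
  obtain ⟨j, rfl⟩ := hn
  obtain ⟨k, hk, hne⟩ : ∃ k < s, y k ≠ x k := by simpa [cylAt] using hy
  rw [mul_comm, ker_mul hm, ker_M_eq_zero hm hk hne, mul_zero]

end Vilenkin

/-- If the distribution function of `u` is dominated by `C` times that of `v`, then so is
its integral. -/
lemma lintegral_le_of_meas_lt_le {Ω : Type*} [MeasurableSpace Ω] {μ : Measure Ω}
    {u v : Ω → ℝ≥0∞} (hu : Measurable u) (hv : Measurable v) {C : ℝ≥0∞} (hC : C ≠ ⊤)
    (h : ∀ t, μ {x | t < u x} ≤ C * μ {x | t < v x}) :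
    ∫⁻ x, u x ∂μ ≤ C * ∫⁻ x, v x ∂μ := by
  rcases eq_or_ne (∫⁻ x, v x ∂μ) ⊤ with hv' | hv'
  · rcases eq_or_ne C 0 with rfl | hC0
    · have h0 : μ {x | 0 < u x} = 0 := by simpa using h 0
      have : u =ᵐ[μ] 0 := by
        rw [Filter.EventuallyEq, ae_iff]
        simpa [pos_iff_ne_zero] using h0
      simp [lintegral_congr_ae this]
    · simp [hv', ENNReal.mul_top hC0]
  have hvfin : ∀ᵐ x ∂μ, v x < ⊤ := ae_lt_top hv hv'
  have hufin : ∀ᵐ x ∂μ, u x < ⊤ := by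
    have htop : μ {x | u x = ⊤} = 0 := by
      by_contra hne
      obtain ⟨n, hn⟩ := ENNReal.exists_nat_mul_gt hne (ENNReal.mul_ne_top hC hv')
      refine hn.not_ge ?_
      have h1 : μ {x | u x = ⊤} ≤ C * μ {x | (n : ℝ≥0∞) ≤ v x} :=
        calc μ {x | u x = ⊤} ≤ μ {x | (n : ℝ≥0∞) < u x} :=
              measure_mono fun x (hx : u x = ⊤) => by simp [hx]
          _ ≤ C * μ {x | (n : ℝ≥0∞) < v x} := h n
          _ ≤ _ := by gcongr; exact le_of_lt
      calc (n : ℝ≥0∞) * μ {x | u x = ⊤} ≤ n * (C * μ {x | (n : ℝ≥0∞) ≤ v x}) := by gcongr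
        _ = C * (n * μ {x | (n : ℝ≥0∞) ≤ v x}) := by ring
        _ ≤ C * ∫⁻ x, v x ∂μ := by gcongr; exact mul_meas_ge_le_lintegral hv _
    rw [ae_iff]
    simpa using htop
  have cake : ∀ {w : Ω → ℝ≥0∞}, Measurable w → (∀ᵐ x ∂μ, w x < ⊤) →
      ∫⁻ x, w x ∂μ = ∫⁻ t in Set.Ioi (0 : ℝ), μ {x | ENNReal.ofReal t < w x} := by
    intro w hw hfin
    have e1 : ∫⁻ x, w x ∂μ = ∫⁻ x, ENNReal.ofReal (w x).toReal ∂μ :=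
      lintegral_congr_ae (hfin.mono fun x hx => (ENNReal.ofReal_toReal hx.ne).symm)
    rw [e1, lintegral_eq_lintegral_meas_lt μ (.of_forall fun x => ENNReal.toReal_nonneg)
      hw.ennreal_toReal.aemeasurable]
    refine setLIntegral_congr_fun measurableSet_Ioi fun t ht => ?_
    refine measure_congr (hfin.mono fun x hx => ?_)
    exact propext (ENNReal.ofReal_lt_iff_lt_toReal (le_of_lt ht) hx.ne).symm
  rw [cake hu hufin, cake hv hvfin, ← lintegral_const_mul' _ _ hC]
  exact lintegral_mono fun t => h _

namespace Vilenkin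

variable {m : ℕ → ℕ}

/-- The first `n` coordinates of a point of `G_m`. -/
def res (n : ℕ) (x : Gm m) : ∀ k : Fin n, ZMod (m k) := fun k => x k

/-- The extension by zero of a vector of `n` coordinates. -/
def ext {n : ℕ} (v : ∀ k : Fin n, ZMod (m k)) : Gm m :=
  fun k => if h : k < n then v ⟨k, h⟩ else 0

lemma ext_res {n k : ℕ} (h : k < n) (x : Gm m) : ext (res n x) k = x k := by
  simp [ext, res, h]

lemma res_ext {n : ℕ} (v : ∀ k : Fin n, ZMod (m k)) : res n (ext v) = v := by
  ext k; simp [ext, res]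

lemma measurable_res (n : ℕ) : Measurable (res n : Gm m → _) :=
  measurable_pi_lambda _ fun k => measurable_pi_apply (k : ℕ)

lemma cylAt_eq_preimage (n : ℕ) (x : Gm m) : cylAt m n x = res n ⁻¹' {res n x} := by
  ext y
  simp only [cylAt, Set.mem_ofPred_eq, Set.mem_preimage, Set.mem_singleton_iff, funext_iff, res]
  exact ⟨fun h k => h k k.2, fun h k hk => h ⟨k, hk⟩⟩

lemma finite_res (hm : ∀ k, 2 ≤ m k) (n : ℕ) : Finite (∀ k : Fin n, ZMod (m k)) := by
  have : ∀ k, NeZero (m k) := fun k => ⟨by have := hm k; omega⟩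
  infer_instance

lemma measurable_of_adapted (hm : ∀ k, 2 ≤ m k) {β : Type*} [MeasurableSpace β] {n : ℕ}
    {g : Gm m → β} (hg : ∀ x y, (∀ k < n, x k = y k) → g x = g y) : Measurable g := by
  have := finite_res hm n
  have e : g = (g ∘ ext) ∘ res n := funext fun x => hg _ _ fun k hk => (ext_res hk x).symm
  rw [e]
  exact (measurable_of_countable _).comp (measurable_res n)

lemma measurableSet_cylAt (hm : ∀ k, 2 ≤ m k) (n : ℕ) (x : Gm m) :
    MeasurableSet (cylAt m n x) := by
  have := finite_res hm n
  rw [cylAt_eq_preimage]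
  exact measurable_res n (measurableSet_singleton _)

lemma cylAt_eq_of_mem {n : ℕ} {x y : Gm m} (h : ∀ k < n, x k = y k) :
    cylAt m n x = cylAt m n y := by
  ext z
  exact ⟨fun hz k hk => (hz k hk).trans (h k hk), fun hz k hk => (hz k hk).trans (h k hk).symm⟩

/-- Two measures are comparable on a set saturated for the cylinders of length `s` when they are
comparable on each of its cylinders. -/
lemma measure_le_of_cylAt (hm : ∀ k, 2 ≤ m k) {μ : Measure (Gm m)} {C : ℝ≥0∞} {s : ℕ}
    {A E : Set (Gm m)} (hsat : ∀ x ∈ A, cylAt m s x ⊆ A)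
    (h : ∀ x ∈ A, μ (cylAt m s x) ≤ C * μ (E ∩ cylAt m s x)) : μ A ≤ C * μ (E ∩ A) := by
  have := finite_res hm s
  have := Fintype.ofFinite (∀ k : Fin s, ZMod (m k))
  have hmeas : ∀ v : ∀ k : Fin s, ZMod (m k), MeasurableSet (res s ⁻¹' {v} : Set (Gm m)) :=
    fun v => measurable_res s (measurableSet_singleton v)
  have split : ∀ B : Set (Gm m), μ B = ∑ v, μ (res s ⁻¹' {v} ∩ B) := fun B => by
    have := sum_measure_preimage_singleton (μ := μ.restrict B) univ fun v _ => hmeas v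
    simpa [Measure.restrict_apply (hmeas _)] using this.symm
  rw [split A, split (E ∩ A), Finset.mul_sum]
  refine Finset.sum_le_sum fun v _ => ?_
  rcases Set.eq_empty_or_nonempty (res s ⁻¹' {v} ∩ A) with he | ⟨x, hxv, hxA⟩
  · simp [he]
  · have hv : (res s ⁻¹' {v} : Set (Gm m)) = cylAt m s x := by
      rw [cylAt_eq_preimage, Set.mem_singleton_iff.1 hxv]
    rw [hv]
    calc μ (cylAt m s x ∩ A) ≤ μ (cylAt m s x) := measure_mono Set.inter_subset_left
      _ ≤ C * μ (E ∩ cylAt m s x) := h x hxA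
      _ ≤ C * μ (cylAt m s x ∩ (E ∩ A)) := by
        refine mul_le_mul_right (measure_mono fun y hy => ?_) C
        exact ⟨hy.2, hy.1, hsat x hxA hy.2⟩

/-- Weak type inequality for the martingale maximal function of an indicator. -/
lemma measure_exists_cylAt_le (hm : ∀ k, 2 ≤ m k) {μ : Measure (Gm m)} {C : ℝ≥0∞}
    {E : Set (Gm m)} (hE : MeasurableSet E) :
    μ {x | ∃ s, μ (cylAt m s x) ≤ C * μ (E ∩ cylAt m s x)} ≤ C * μ E := by
  set Q : ℕ → Gm m → Prop := fun s x => μ (cylAt m s x) ≤ C * μ (E ∩ cylAt m s x) with hQ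
  have hQad : ∀ s x y, (∀ k < s, x k = y k) → Q s x = Q s y := fun s x y h => by
    simp only [hQ, cylAt_eq_of_mem h]
  set A : ℕ → Set (Gm m) := fun s => {x | Q s x ∧ ∀ r < s, ¬ Q r x} with hA
  have hAad : ∀ s x y, (∀ k < s, x k = y k) → (x ∈ A s) = (y ∈ A s) := fun s x y h => by
    simp only [hA, Set.mem_ofPred_eq, hQad s x y h]
    congr 1
    refine propext (forall₂_congr fun r hr => ?_)
    rw [hQad r x y fun k hk => h k (hk.trans hr)]
  have hAmeas : ∀ s, MeasurableSet (A s) := fun s =>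
    measurableSet_setOfPred.2 (measurable_of_adapted hm (hAad s))
  have hdisj : Pairwise (Function.onFun Disjoint fun s => E ∩ A s) := by
    intro s r hsr
    refine Set.disjoint_left.2 fun x hs hr => ?_
    rcases lt_or_gt_of_ne hsr with h | h
    · exact hr.2.2 s h hs.2.1
    · exact hs.2.2 r h hr.2.1
  calc μ {x | ∃ s, Q s x} ≤ μ (⋃ s, A s) := by
        classical
        refine measure_mono fun x (hx : ∃ s, Q s x) => Set.mem_iUnion.2 ⟨Nat.find hx, ?_⟩
        exact ⟨Nat.find_spec hx, fun r hr => Nat.find_min hx hr⟩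
    _ ≤ ∑' s, μ (A s) := measure_iUnion_le _
    _ ≤ ∑' s, C * μ (E ∩ A s) := by
        refine ENNReal.tsum_le_tsum fun s => measure_le_of_cylAt hm (s := s) ?_ fun x hx => hx.1
        exact fun x hx y hy => (hAad s y x hy).mpr hx
    _ = C * μ (⋃ s, E ∩ A s) := by
        rw [ENNReal.tsum_mul_left, measure_iUnion hdisj fun s => hE.inter (hAmeas s)]
    _ ≤ C * μ E := by
        gcongr
        exact Set.iUnion_subset fun s => Set.inter_subset_left

variable {μ : Measure (Gm m)} {f : ℕ → Gm m → ℂ}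

lemma IsMartingale.measurable (hm : ∀ k, 2 ≤ m k) (hf : IsMartingale m μ f) (n : ℕ) :
    Measurable (f n) := measurable_of_adapted hm (hf.adapted n)

lemma IsMartingale.integral_mul (hm : ∀ k, 2 ≤ m k) (hf : IsMartingale m μ f) {a b : ℕ}
    (hab : a ≤ b) {h : Gm m → ℂ} (hh : ∀ x y, (∀ k < a, x k = y k) → h x = h y) :
    ∫ x, f b x * h x ∂μ = ∫ x, f a x * h x ∂μ := by
  have := finite_res hm a
  have := Fintype.ofFinite (∀ k : Fin a, ZMod (m k))
  have hcyl : ∀ v : ∀ k : Fin a, ZMod (m k),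
      (res a ⁻¹' {v} : Set (Gm m)) = cylAt m a (ext v) := fun v => by
    rw [cylAt_eq_preimage, res_ext]
  have hconst : ∀ (n : ℕ) (v : ∀ k : Fin a, ZMod (m k)),
      Set.EqOn (fun x => f n x * h x) (fun x => f n x * h (ext v)) (res a ⁻¹' {v}) :=
    fun n v x hx => by
      rw [hcyl] at hx
      simp only [hh x (ext v) hx]
  have hmeas : ∀ v : ∀ k : Fin a, ZMod (m k), MeasurableSet (res a ⁻¹' {v} : Set (Gm m)) :=
    fun v => measurable_res a (measurableSet_singleton v)
  have split : ∀ n, ∫ x, f n x * h x ∂μ =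
      ∑ v : ∀ k : Fin a, ZMod (m k), (∫ x in cylAt m a (ext v), f n x ∂μ) * h (ext v) := by
    intro n
    have hU : (⋃ v, (res a ⁻¹' {v} : Set (Gm m))) = Set.univ := by
      ext x; simp
    rw [← setIntegral_univ, ← hU, integral_iUnion_fintype hmeas]
    · refine Finset.sum_congr rfl fun v _ => ?_
      rw [setIntegral_congr_fun (hmeas v) (hconst n v), integral_mul_const, hcyl]
    · intro v w hvw
      refine Set.disjoint_left.2 fun x hx hy => hvw ?_
      exact (Set.mem_singleton_iff.1 hx).symm.trans hy
    · exact fun v => ((hf.integrable n).mul_const _).integrableOn.congr_fun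
        (hconst n v).symm (hmeas v)
  rw [split, split]
  refine Finset.sum_congr rfl fun v _ => ?_
  have hM : (M m a : ℂ) ≠ 0 := Nat.cast_ne_zero.2 (M_pos hm a).ne'
  rw [mul_left_cancel₀ hM ((hf.mart a b hab (ext v)).symm.trans (hf.mart a a le_rfl (ext v)))]

lemma vil_adapted {i n : ℕ} (hm : ∀ k, 2 ≤ m k) (hi : i < M m n) (x y : Gm m)
    (h : ∀ k < n, x k = y k) : vil m i x = vil m i y := by
  refine Finset.prod_congr rfl fun k _ => ?_
  rcases lt_or_ge k n with hk | hk
  · rw [rad, rad, h k hk]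
  · rw [digit_eq_zero_of_lt (hi.trans_le (M_le_M hm hk)), pow_zero, pow_zero]

lemma measurable_vil (hm : ∀ k, 2 ≤ m k) (i : ℕ) : Measurable (vil m i) :=
  measurable_of_adapted hm (vil_adapted hm (lt_M hm i))

lemma IsMartingale.coeff_eq (hm : ∀ k, 2 ≤ m k) (hf : IsMartingale m μ f) {i n : ℕ}
    (hi : i < M m n) : coeff m μ f i = ∫ x, f n x * (starRingEnd ℂ) (vil m i x) ∂μ := by
  rcases le_total n (i + 1) with h | h
  · exact hf.integral_mul hm h fun x y hxy => by rw [vil_adapted hm hi x y hxy]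
  · refine (hf.integral_mul hm h fun x y hxy => ?_).symm
    rw [vil_adapted hm ((Nat.lt_succ_self i).trans (lt_M hm (i + 1))) x y hxy]

lemma IsMartingale.S_eq (hm : ∀ k, 2 ≤ m k) (hf : IsMartingale m μ f) {n N : ℕ}
    (hn : n ≤ M m N) (x : Gm m) : S m μ f n x = ∫ y, f N y * ker n x y ∂μ := by
  simp only [ker, Finset.mul_sum]
  rw [integral_finsetSum]
  · refine Finset.sum_congr rfl fun k hk => ?_
    rw [hf.coeff_eq hm ((mem_range.1 hk).trans_le hn), ← integral_mul_const]
    congr 1; ext y; ring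
  · intro k _
    refine (hf.integrable N).mul_bdd (c := 1) ?_ (.of_forall fun y => by simp [norm_vil])
    exact (((Complex.continuous_conj.measurable.comp
      (measurable_vil hm k)).const_mul _)).aestronglyMeasurable

/-- If `M_s` divides `n`, then `S_n f (x)` is controlled by the values of the martingale on the
cylinder of length `s` around `x`. -/
lemma IsMartingale.enorm_S_le (hm : ∀ k, 2 ≤ m k) (hμ : IsHaar m μ) (hf : IsMartingale m μ f)
    {n s N : ℕ} (hs : M m s ∣ n) (hN : n ≤ M m N) {C : ℕ} (hC : n ≤ C * M m s) {x : Gm m}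
    {t : ℝ≥0∞} (ht : ∀ y ∈ cylAt m s x, ‖f N y‖ₑ ≤ t) : ‖S m μ f n x‖ₑ ≤ C * t := by
  rw [hf.S_eq hm hN]
  have hM : (M m s : ℝ≥0∞) ≠ 0 := Nat.cast_ne_zero.2 (M_pos hm s).ne'
  calc ‖∫ y, f N y * ker n x y ∂μ‖ₑ ≤ ∫⁻ y, ‖f N y * ker n x y‖ₑ ∂μ :=
        enorm_integral_le_lintegral_enorm _
    _ ≤ ∫⁻ y, (cylAt m s x).indicator (fun _ => t * n) y ∂μ := by
        refine lintegral_mono fun y => ?_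
        by_cases hy : y ∈ cylAt m s x
        · rw [Set.indicator_of_mem hy, enorm_mul]
          gcongr
          · exact ht y hy
          · rw [← ofReal_norm, ← ENNReal.ofReal_natCast]
            exact ENNReal.ofReal_le_ofReal (norm_ker_le n x y)
        · rw [ker_eq_zero hm hs hy]; simp
    _ = t * n * (M m s : ℝ≥0∞)⁻¹ := by
        rw [lintegral_indicator_const (measurableSet_cylAt hm s x), hμ]
    _ ≤ t * (C * M m s : ℕ) * (M m s : ℝ≥0∞)⁻¹ := by gcongr
    _ = C * t := by
        rw [Nat.cast_mul, ← mul_assoc, mul_assoc, ENNReal.mul_inv_cancel hM (by simp), mul_one,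
          mul_comm]

lemma measurable_S (hm : ∀ k, 2 ≤ m k) (n : ℕ) : Measurable (S m μ f n) :=
  Finset.measurable_sum _ fun k _ => (measurable_vil hm k).const_mul _

lemma IsMartingale.measurable_mstar (hm : ∀ k, 2 ≤ m k) (hf : IsMartingale m μ f) :
    Measurable (mstar m f) :=
  Measurable.iSup fun n => (hf.measurable hm n).enorm

/-- Distributional inequality for the restricted maximal operator. -/
lemma IsMartingale.meas_iSup_S_le {lam kap : ℕ} (hm : ∀ k, 2 ≤ m k) (hlam : ∀ k, m k ≤ lam)
    {α : ℕ → ℕ} (hα : ∀ k, hi m (α k) - lo m (α k) ≤ kap) (hμ : IsHaar m μ)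
    (hf : IsMartingale m μ f) (t : ℝ≥0∞) :
    μ {x | ((lam ^ (kap + 1) : ℕ) : ℝ≥0∞) * t < ⨆ k, ‖S m μ f (α k) x‖ₑ} ≤
      ((lam ^ (kap + 1) : ℕ) : ℝ≥0∞) * μ {x | t < mstar m f x} := by
  have hE : MeasurableSet {x | t < mstar m f x} :=
    measurableSet_lt measurable_const (hf.measurable_mstar hm)
  refine (measure_mono fun x hx => ?_).trans (measure_exists_cylAt_le hm hE)
  rw [Set.mem_ofPred_eq, lt_iSup_iff] at hx
  obtain ⟨k, hk⟩ := hx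
  set s := lo m (α k) with hs
  set N := max (hi m (α k) + 1) s with hNdef
  have hMN : M m N ≤ lam ^ (kap + 1) * M m s := by
    obtain ⟨d, hd⟩ : ∃ d, N = s + d := Nat.exists_eq_add_of_le (le_max_right _ _)
    have hdk : d ≤ kap + 1 := by have := hα k; omega
    rw [hd]
    refine (M_add_le hlam s d).trans (Nat.mul_le_mul_right _ (Nat.pow_le_pow_right ?_ hdk))
    have := (hm 0).trans (hlam 0)
    omega
  have hαN : α k ≤ M m N := (lt_M_hi_succ hm (α k)).le.trans (M_le_M hm (le_max_left _ _))
  obtain ⟨y, hy, hty⟩ : ∃ y ∈ cylAt m s x, t < ‖f N y‖ₑ := by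
    by_contra! hcon
    exact hk.not_ge (hf.enorm_S_le hm hμ (M_lo_dvd _) hαN (hαN.trans hMN) hcon)
  refine ⟨s, ?_⟩
  have hsub : cylAt m N y ⊆ {x | t < mstar m f x} ∩ cylAt m s x := fun z hz => by
    refine ⟨hty.trans_le ?_, fun j hj => (hz j (hj.trans_le (le_max_right _ _))).trans (hy j hj)⟩
    rw [← hf.adapted N z y hz]
    exact le_iSup (fun n => ‖f n z‖ₑ) N
  have h0 : ∀ n, (M m n : ℝ≥0∞) ≠ 0 := fun n => Nat.cast_ne_zero.2 (M_pos hm n).ne'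
  calc μ (cylAt m s x) = (M m s : ℝ≥0∞)⁻¹ := hμ s x
    _ ≤ (lam ^ (kap + 1) : ℕ) * (M m N : ℝ≥0∞)⁻¹ := by
        rw [← div_eq_mul_inv, ENNReal.le_div_iff_mul_le (.inl (h0 N)) (.inl (by simp)), mul_comm,
          ← div_eq_mul_inv, ENNReal.div_le_iff (h0 s) (by simp)]
        exact_mod_cast hMN
    _ = (lam ^ (kap + 1) : ℕ) * μ (cylAt m N y) := by rw [hμ N y]
    _ ≤ _ := by gcongr

end Vilenkin

/-- for `0 < p ≤ 1` and a sequence `(α_k)` of positive integers with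
`sup_k (|α_k| - ⟨α_k⟩) ≤ ϰ < ∞`, the restricted maximal operator of partial sums
satisfies `‖ sup_k |S_{α_k} f| ‖_{L_p} ≤ c ‖f‖_{H_p}` with `c > 0` depending only
on `p`, `λ = sup m_k` and `ϰ`. -/
theorem statement11 (p : ℝ) (hp0 : 0 < p) (hp1 : p ≤ 1) (lam kap : ℕ) :
    ∃ c : ℝ, 0 < c ∧
      ∀ (m : ℕ → ℕ), (∀ k, 2 ≤ m k) → (∀ k, m k ≤ lam) →
      ∀ (α : ℕ → ℕ), (∀ k, 0 < α k) →
        (∀ k, Vilenkin.hi m (α k) - Vilenkin.lo m (α k) ≤ kap) →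
      ∀ (μ : Measure (Gm m)), Vilenkin.IsHaar m μ →
      ∀ (f : ℕ → Gm m → ℂ), Vilenkin.IsMartingale m μ f → Vilenkin.MemHp m μ p f →
        Vilenkin.eLp m μ p
            (fun x => ⨆ k : ℕ, (‖Vilenkin.S m μ f (α k) x‖₊ : ℝ≥0∞)) ≤
          ENNReal.ofReal c * Vilenkin.eLp m μ p (Vilenkin.mstar m f) := by
  set K : ℕ := max (lam ^ (kap + 1)) 1 with hK
  have hK0 : (0 : ℝ) < K := by positivity
  refine ⟨((K : ℝ) * (K : ℝ) ^ p) ^ (1 / p), by positivity, ?_⟩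
  intro m hm hlam α _ hα μ hμ f hf _
  have hlam0 : 0 < lam ^ (kap + 1) := pow_pos (by have := (hm 0).trans (hlam 0); omega) _
  have hKeq : K = lam ^ (kap + 1) := max_eq_left hlam0
  have hKE : (K : ℝ≥0∞) ≠ 0 := by rw [hKeq]; exact Nat.cast_ne_zero.2 hlam0.ne'
  have hdist : ∀ t : ℝ≥0∞, μ {x | t < (⨆ k, ‖Vilenkin.S m μ f (α k) x‖ₑ) ^ p} ≤
      K * μ {x | t < (K * Vilenkin.mstar m f x) ^ p} := by
    intro t
    have := hf.meas_iSup_S_le hm hlam hα hμ (t ^ p⁻¹ / K)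
    rw [← hKeq, ENNReal.mul_div_cancel hKE (by simp)] at this
    simpa only [ENNReal.div_lt_iff (.inl hKE) (.inl (ENNReal.natCast_ne_top K)),
      ENNReal.rpow_inv_lt_iff hp0, mul_comm (Vilenkin.mstar m f _)] using this
  have hint : ∫⁻ x, (⨆ k, ‖Vilenkin.S m μ f (α k) x‖ₑ) ^ p ∂μ ≤
      K * (K : ℝ≥0∞) ^ p * ∫⁻ x, Vilenkin.mstar m f x ^ p ∂μ := by
    have h := lintegral_le_of_meas_lt_le
      ((Measurable.iSup fun k => (Vilenkin.measurable_S hm (α k)).enorm).pow_const p)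
      (((hf.measurable_mstar hm).const_mul (K : ℝ≥0∞)).pow_const p)
      (ENNReal.natCast_ne_top K) hdist
    simp only [ENNReal.mul_rpow_of_nonneg _ _ hp0.le] at h
    rwa [lintegral_const_mul _ ((hf.measurable_mstar hm).pow_const p), ← mul_assoc] at h
  have hc : ENNReal.ofReal (((K : ℝ) * (K : ℝ) ^ p) ^ (1 / p)) =
      (K * (K : ℝ≥0∞) ^ p) ^ (1 / p) := by
    rw [← ENNReal.ofReal_rpow_of_pos (by positivity), ENNReal.ofReal_mul hK0.le,
      ← ENNReal.ofReal_rpow_of_pos hK0, ENNReal.ofReal_natCast]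
  rw [hc, Vilenkin.eLp, Vilenkin.eLp, ← ENNReal.mul_rpow_of_nonneg _ _ (by positivity)]
  exact ENNReal.rpow_le_rpow hint (by positivity)
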